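/- arXiv:2208.10860 — 5 statements merged into one kernel-verified Lean document; each statement's English description precedes it below -/
import Mathlib

section
/- For every t ∈ ℝ and α ∈ ℝ^{L−1}, the determinant of the L×L matrix g(t,α) equals N(t)·B(t) + A(t,α)², where N(t) = 1 + Σ_{m=1}^{L−1} p_m(t)². -/
/-!
Formalization of results from "A geometric approach to equilibrium selection":
the metric, Christoffel symbols and curvature of the equilibrium manifold of a
two-consumer exchange economy with `L` goods, parametrized by
`Φ(t,α) = (p_1(t),…,p_{L−1}(t), α_1,…,α_{L−1}, w(t) − Σ_m p_m(t) α_m)`.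

Indices run over `Fin L`, where the index `0` corresponds to the coordinate
`x_0 = t` and an index `i ≠ 0` corresponds to the coordinate `x_i = α_i`
(the component `α 0` of `α : Fin L → ℝ` is never used, so `α` is just a copy
of `ℝ^{L−1}` together with an irrelevant extra coordinate).
-/

open Matrix BigOperators

noncomputable section

namespace EqSelection

variable {L : ℕ}

/-- `A(t,α) = w'(t) − Σ_{m=1}^{L−1} p_m'(t) α_m`. -/
def eqA [NeZero L] (p : Fin L → ℝ → ℝ) (w : ℝ → ℝ) (t : ℝ) (α : Fin L → ℝ) : ℝ :=
  deriv w t - ∑ m ∈ Finset.univ \ {0}, deriv (p m) t * α m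

/-- `A'(t,α) = w''(t) − Σ_{m=1}^{L−1} p_m''(t) α_m`. -/
def eqA' [NeZero L] (p : Fin L → ℝ → ℝ) (w : ℝ → ℝ) (t : ℝ) (α : Fin L → ℝ) : ℝ :=
  deriv (deriv w) t - ∑ m ∈ Finset.univ \ {0}, deriv (deriv (p m)) t * α m

/-- `B(t) = Σ_{m=1}^{L−1} (p_m'(t))²`. -/
def eqB [NeZero L] (p : Fin L → ℝ → ℝ) (t : ℝ) : ℝ :=
  ∑ m ∈ Finset.univ \ {0}, (deriv (p m) t) ^ 2

/-- `N(t) = 1 + Σ_{m=1}^{L−1} (p_m(t))²`. -/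
def eqN [NeZero L] (p : Fin L → ℝ → ℝ) (t : ℝ) : ℝ :=
  1 + ∑ m ∈ Finset.univ \ {0}, (p m t) ^ 2

/-- `C(t) = Σ_{m=1}^{L−1} p_m'(t) p_m''(t)`. -/
def eqC [NeZero L] (p : Fin L → ℝ → ℝ) (t : ℝ) : ℝ :=
  ∑ m ∈ Finset.univ \ {0}, deriv (p m) t * deriv (deriv (p m)) t

/-- `P(t) = Σ_{m=1}^{L−1} p_m(t) p_m'(t)`. -/
def eqP [NeZero L] (p : Fin L → ℝ → ℝ) (t : ℝ) : ℝ :=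
  ∑ m ∈ Finset.univ \ {0}, p m t * deriv (p m) t

/-- The induced metric matrix `g(t,α)`: `g_{00} = B + A²`, `g_{0i} = g_{i0} = −p_i A`,
`g_{ij} = p_i p_j + δ_{ij}` for `i, j ≠ 0`. -/
def gMat [NeZero L] (p : Fin L → ℝ → ℝ) (w : ℝ → ℝ) (t : ℝ) (α : Fin L → ℝ) :
    Matrix (Fin L) (Fin L) ℝ :=
  Matrix.of fun i j =>
    if i = 0 then
      if j = 0 then eqB p t + (eqA p w t α) ^ 2 else -(p j t) * eqA p w t α
    else
      if j = 0 then -(p i t) * eqA p w t α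
      else p i t * p j t + (if i = j then 1 else 0)

/-- Partial derivative with respect to the coordinate `x_k`, where `x_0 = t`
and `x_i = α_i` for `i ≠ 0`. -/
def pder [NeZero L] (k : Fin L) (f : ℝ → (Fin L → ℝ) → ℝ) (t : ℝ) (α : Fin L → ℝ) : ℝ :=
  if k = 0 then deriv (fun s => f s α) t
  else deriv (fun s => f t (Function.update α k s)) (α k)

/-- Christoffel symbol
`Γ^k_{ij} = (1/2) Σ_{h=0}^{L−1} g^{hk} (∂g_{jh}/∂x_i + ∂g_{hi}/∂x_j − ∂g_{ij}/∂x_h)`,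
written `christoffel p w i j k`.  (Here `g^{hk}` denotes the entries of the inverse
matrix of `g`, i.e. of `(gMat p w t α)⁻¹`.) -/
def christoffel [NeZero L] (p : Fin L → ℝ → ℝ) (w : ℝ → ℝ) (i j k : Fin L)
    (t : ℝ) (α : Fin L → ℝ) : ℝ :=
  (1 / 2) * ∑ h : Fin L,
    (gMat p w t α)⁻¹ h k *
      (pder i (fun t' α' => gMat p w t' α' j h) t α
        + pder j (fun t' α' => gMat p w t' α' h i) t α
        - pder h (fun t' α' => gMat p w t' α' i j) t α)

/-- Curvature coefficient
`R^s_{ijk} = Σ_{m} Γ^m_{ik} Γ^s_{jm} − Σ_{m} Γ^m_{jk} Γ^s_{im} + ∂Γ^s_{ik}/∂x_j − ∂Γ^s_{jk}/∂x_i`,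
written `curvR p w i j k s`. -/
def curvR [NeZero L] (p : Fin L → ℝ → ℝ) (w : ℝ → ℝ) (i j k s : Fin L)
    (t : ℝ) (α : Fin L → ℝ) : ℝ :=
  (∑ m : Fin L, christoffel p w i k m t α * christoffel p w j m s t α)
    - (∑ m : Fin L, christoffel p w j k m t α * christoffel p w i m s t α)
    + pder j (christoffel p w i k s) t α - pder i (christoffel p w j k s) t α

/-- The coordinate tangent vectors `Φ_i(t,α) ∈ ℝ^{2L−1}` of the parametrization
`Φ(t,α) = (p_1(t),…,p_{L−1}(t), α_1,…,α_{L−1}, w(t) − Σ_m p_m(t) α_m)`: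
`Φ_0 = (p_1',…,p_{L−1}', 0,…,0, A)`, and for `i ≠ 0` the vector `Φ_i` has entry `1`
in position `(L−1)+i` (1-indexed), entry `−p_i` in the last position and `0` elsewhere. -/
def PhiVec [NeZero L] (p : Fin L → ℝ → ℝ) (w : ℝ → ℝ) (i : Fin L)
    (t : ℝ) (α : Fin L → ℝ) : Fin (2 * L - 1) → ℝ :=
  fun j =>
    if i = 0 then
      if h : (j : ℕ) < L - 1 then deriv (p ⟨(j : ℕ) + 1, by omega⟩) t
      else if (j : ℕ) = 2 * L - 2 then eqA p w t α else 0
    else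
      if (j : ℕ) + 1 = (L - 1) + (i : ℕ) then 1
      else if (j : ℕ) = 2 * L - 2 then -(p i t) else 0

/-- The matrix `M(t,α)` of Statement 2: `M_{00} = N`, `M_{0i} = M_{i0} = p_i A`,
`M_{ii} = (N − p_i²) B + A²`, `M_{ij} = −p_i p_j B` for `i ≠ j`, `i, j ≠ 0`. -/
def invNumer [NeZero L] (p : Fin L → ℝ → ℝ) (w : ℝ → ℝ) (t : ℝ) (α : Fin L → ℝ) :
    Matrix (Fin L) (Fin L) ℝ :=
  Matrix.of fun i j =>
    if i = 0 then
      if j = 0 then eqN p t else p j t * eqA p w t α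
    else
      if j = 0 then p i t * eqA p w t α
      else if i = j then (eqN p t - (p i t) ^ 2) * eqB p t + (eqA p w t α) ^ 2
      else -(p i t * p j t * eqB p t)

/-- Weinstein–Aronszajn: a rank-one update of the matrix `diag(b, 1, …, 1)`. -/
theorem det_one_add_single_add_vecMulVec {n : Type*} [Fintype n] [DecidableEq n]
    (k : n) (b : ℝ) (u : n → ℝ) :
    (1 + Matrix.single k k (b - 1) + vecMulVec u u).det
      = b * (1 + u ⬝ᵥ u) - (b - 1) * u k ^ 2 := by
  have hfactor : 1 + Matrix.single k k (b - 1) + vecMulVec u u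
      = 1 + (Matrix.of ![Pi.single k 1, u])ᵀ * Matrix.of ![Pi.single k (b - 1), u] := by
    ext i j
    simp only [Matrix.add_apply, Matrix.mul_apply, Fin.sum_univ_two, vecMulVec_apply,
      Matrix.single_apply, add_assoc]
    by_cases hi : i = k <;> by_cases hj : j = k <;>
      simp [hi, hj, eq_comm (a := k)]
  rw [hfactor, Matrix.det_one_add_mul_comm, Matrix.det_fin_two]
  simp only [Matrix.add_apply, Matrix.mul_apply, Matrix.transpose_apply, Matrix.of_apply]
  simp [Pi.single_apply, dotProduct]
  ring

theorem statement_1 (L : ℕ) [NeZero L] (hL : 2 ≤ L)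
    (p : Fin L → ℝ → ℝ) (w : ℝ → ℝ)
    (hp : ∀ i, ContDiff ℝ (⊤ : ℕ∞) (p i)) (hw : ContDiff ℝ (⊤ : ℕ∞) w) :
    ∀ (t : ℝ) (α : Fin L → ℝ),
      (gMat p w t α).det = eqN p t * eqB p t + (eqA p w t α) ^ 2 := by
  intro t α
  let u : Fin L → ℝ := fun i => if i = 0 then eqA p w t α else -(p i t)
  have hg : gMat p w t α = 1 + Matrix.single 0 0 (eqB p t - 1) + vecMulVec u u := by
    ext i j
    simp only [gMat, u, Matrix.of_apply, Matrix.add_apply, Matrix.one_apply, vecMulVec_apply,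
      Matrix.single_apply]
    by_cases hi : i = 0 <;> by_cases hj : j = 0
    · simp [hi, hj]
      ring
    · simp [hi, hj, Ne.symm hj]
      ring
    · simp [hi, hj, Ne.symm hi]
    · simp [hi, hj, Ne.symm hi]
      ring
  have hu : u ⬝ᵥ u = eqA p w t α ^ 2 + ∑ m ∈ Finset.univ \ {0}, p m t ^ 2 := by
    rw [dotProduct, ← Finset.add_sum_erase _ _ (Finset.mem_univ 0), Finset.sdiff_singleton_eq_erase]
    congr 1
    · simp [u, sq]
    · refine Finset.sum_congr rfl fun m hm => ?_
      simp [u, Finset.ne_of_mem_erase hm, sq]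
  rw [hg, det_one_add_single_add_vecMulVec, hu, eqN]
  simp only [u, if_true]
  ring

end EqSelection
end
end

section
/- For every t ∈ ℝ and α ∈ ℝ^{L−1}, the L×L matrix M(t,α) with entries M_{00} = N(t), M_{0i} = M_{i0} = p_i(t) A(t,α) for 1 ≤ i ≤ L−1, M_{ii} = (N(t) − p_i(t)²) B(t) + A(t,α)² for 1 ≤ i ≤ L−1, and M_{ij} = −p_i(t) p_j(t) B(t) for 1 ≤ i ≠ j ≤ L−1, satisfies g(t,α) · M(t,α) = (N(t) B(t) + A(t,α)²) · I_L. In particular, whenever N(t)B(t) + A(t,α)² ≠ 0, the inverse of g(t,α) is (N B + A²)^{−1} M(t,α). -/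
/-!
Formalization of results from "A geometric approach to equilibrium selection":
the metric, Christoffel symbols and curvature of the equilibrium manifold of a
two-consumer exchange economy with `L` goods, parametrized by
`Φ(t,α) = (p_1(t),…,p_{L−1}(t), α_1,…,α_{L−1}, w(t) − Σ_m p_m(t) α_m)`.

Indices run over `Fin L`, where the index `0` corresponds to the coordinate
`x_0 = t` and an index `i ≠ 0` corresponds to the coordinate `x_i = α_i`
(the component `α 0` of `α : Fin L → ℝ` is never used, so `α` is just a copy
of `ℝ^{L−1}` together with an irrelevant extra coordinate).
-/

open Matrix BigOperators

noncomputable section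

namespace EqSelection

variable {L : ℕ}

/-- Away from the index `0`, `M = (N B + A²) I − B p pᵀ`. -/
theorem invNumer_apply_of_ne_zero [NeZero L] (p : Fin L → ℝ → ℝ) (w : ℝ → ℝ) (t : ℝ)
    (α : Fin L → ℝ) {i j : Fin L} (hi : i ≠ 0) (hj : j ≠ 0) :
    invNumer p w t α i j
      = (if i = j then eqN p t * eqB p t + eqA p w t α ^ 2 else 0) - p i t * p j t * eqB p t := by
  by_cases hij : i = j
  · subst hij
    simp only [invNumer, of_apply, if_neg hi, if_true]
    ring
  · simp [invNumer, hi, hj, hij]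

theorem sum_mul_self_eq_eqN_sub_one [NeZero L] (p : Fin L → ℝ → ℝ) (t : ℝ) :
    ∑ k ∈ Finset.univ \ {0}, p k t * p k t = eqN p t - 1 := by
  simp [eqN, sq]

theorem sum_mul_invNumer_zero [NeZero L] (p : Fin L → ℝ → ℝ) (w : ℝ → ℝ) (t : ℝ)
    (α : Fin L → ℝ) :
    ∑ k ∈ Finset.univ \ {0}, p k t * invNumer p w t α k 0 = (eqN p t - 1) * eqA p w t α := by
  rw [← sum_mul_self_eq_eqN_sub_one, Finset.sum_mul]
  refine Finset.sum_congr rfl fun k hk => ?_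
  have hk0 : k ≠ 0 := by simpa using hk
  simp [invNumer, hk0, mul_assoc]

theorem sum_mul_invNumer_of_ne_zero [NeZero L] (p : Fin L → ℝ → ℝ) (w : ℝ → ℝ) (t : ℝ)
    (α : Fin L → ℝ) {j : Fin L} (hj : j ≠ 0) :
    ∑ k ∈ Finset.univ \ {0}, p k t * invNumer p w t α k j
      = p j t * (eqB p t + eqA p w t α ^ 2) := by
  have h : ∀ k ∈ Finset.univ \ {(0 : Fin L)}, p k t * invNumer p w t α k j
      = (if k = j then p k t * (eqN p t * eqB p t + eqA p w t α ^ 2) else 0)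
        - p k t * p k t * (p j t * eqB p t) := by
    intro k hk
    have hk0 : k ≠ 0 := by simpa using hk
    rw [invNumer_apply_of_ne_zero p w t α hk0 hj]
    split_ifs <;> ring
  have hmem : j ∈ Finset.univ \ {(0 : Fin L)} := by simpa using hj
  rw [Finset.sum_congr rfl h, Finset.sum_sub_distrib, ← Finset.sum_mul,
    sum_mul_self_eq_eqN_sub_one, Finset.sum_ite_eq_of_mem' _ _ _ hmem]
  ring

theorem gMat_mul_apply_zero [NeZero L] (p : Fin L → ℝ → ℝ) (w : ℝ → ℝ) (t : ℝ)
    (α : Fin L → ℝ) (M : Matrix (Fin L) (Fin L) ℝ) (j : Fin L) :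
    (gMat p w t α * M) 0 j = (eqB p t + eqA p w t α ^ 2) * M 0 j
      - eqA p w t α * ∑ k ∈ Finset.univ \ {0}, p k t * M k j := by
  have h : ∀ k ∈ Finset.univ \ {(0 : Fin L)}, gMat p w t α 0 k * M k j
      = -eqA p w t α * (p k t * M k j) := by
    intro k hk
    have hk0 : k ≠ 0 := by simpa using hk
    simp only [gMat, of_apply, if_neg hk0, if_true]
    ring
  rw [mul_apply, ← Finset.sum_sdiff (Finset.subset_univ {(0 : Fin L)}), Finset.sum_singleton,
    Finset.sum_congr rfl h, ← Finset.mul_sum]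
  simp only [gMat, of_apply, if_true]
  ring

theorem gMat_mul_apply_of_ne_zero [NeZero L] (p : Fin L → ℝ → ℝ) (w : ℝ → ℝ) (t : ℝ)
    (α : Fin L → ℝ) (M : Matrix (Fin L) (Fin L) ℝ) {i : Fin L} (hi : i ≠ 0) (j : Fin L) :
    (gMat p w t α * M) i j = -(p i t * eqA p w t α * M 0 j)
      + p i t * (∑ k ∈ Finset.univ \ {0}, p k t * M k j) + M i j := by
  have hmem : i ∈ Finset.univ \ {(0 : Fin L)} := by simpa using hi
  have h : ∀ k ∈ Finset.univ \ {(0 : Fin L)}, gMat p w t α i k * M k j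
      = p i t * (p k t * M k j) + if i = k then M k j else 0 := by
    intro k hk
    have hk0 : k ≠ 0 := by simpa using hk
    simp only [gMat, of_apply, if_neg hi, if_neg hk0]
    split_ifs <;> ring
  rw [mul_apply, ← Finset.sum_sdiff (Finset.subset_univ {(0 : Fin L)}), Finset.sum_singleton,
    Finset.sum_congr rfl h, Finset.sum_add_distrib, ← Finset.mul_sum,
    Finset.sum_ite_eq_of_mem _ _ _ hmem]
  simp only [gMat, of_apply, if_neg hi, if_true]
  ring

theorem gMat_mul_invNumer [NeZero L] (p : Fin L → ℝ → ℝ) (w : ℝ → ℝ) (t : ℝ)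
    (α : Fin L → ℝ) :
    gMat p w t α * invNumer p w t α
      = (eqN p t * eqB p t + eqA p w t α ^ 2) • (1 : Matrix (Fin L) (Fin L) ℝ) := by
  have h00 : invNumer p w t α 0 0 = eqN p t := by simp [invNumer]
  have h0 : ∀ j, j ≠ 0 → invNumer p w t α 0 j = p j t * eqA p w t α := by
    intro j hj
    simp [invNumer, hj]
  have h0' : ∀ i, i ≠ 0 → invNumer p w t α i 0 = p i t * eqA p w t α := by
    intro i hi
    simp [invNumer, hi]
  ext i j
  rw [Matrix.smul_apply, one_apply, smul_eq_mul]
  by_cases hi : i = 0 <;> by_cases hj : j = 0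
  · subst hi hj
    rw [gMat_mul_apply_zero, sum_mul_invNumer_zero, h00, if_pos rfl]
    ring
  · subst hi
    rw [gMat_mul_apply_zero, sum_mul_invNumer_of_ne_zero p w t α hj, h0 j hj,
      if_neg (Ne.symm hj)]
    ring
  · subst hj
    rw [gMat_mul_apply_of_ne_zero p w t α _ hi, sum_mul_invNumer_zero, h00, h0' i hi, if_neg hi]
    ring
  · rw [gMat_mul_apply_of_ne_zero p w t α _ hi, sum_mul_invNumer_of_ne_zero p w t α hj, h0 j hj,
      invNumer_apply_of_ne_zero p w t α hi hj]
    split_ifs <;> ring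

theorem statement_2 (L : ℕ) [NeZero L] (hL : 2 ≤ L)
    (p : Fin L → ℝ → ℝ) (w : ℝ → ℝ)
    (hp : ∀ i, ContDiff ℝ (⊤ : ℕ∞) (p i)) (hw : ContDiff ℝ (⊤ : ℕ∞) w) :
    ∀ (t : ℝ) (α : Fin L → ℝ),
      gMat p w t α * invNumer p w t α
          = (eqN p t * eqB p t + (eqA p w t α) ^ 2) • (1 : Matrix (Fin L) (Fin L) ℝ)
      ∧ ((eqN p t * eqB p t + (eqA p w t α) ^ 2) ≠ 0 →
          (gMat p w t α)⁻¹ = (eqN p t * eqB p t + (eqA p w t α) ^ 2)⁻¹ • invNumer p w t α) := by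
  intro t α
  refine ⟨gMat_mul_invNumer p w t α, fun hD => ?_⟩
  apply Matrix.inv_eq_right_inv
  rw [Matrix.mul_smul, gMat_mul_invNumer, smul_smul, inv_mul_cancel₀ hD, one_smul]

end EqSelection
end
end

section
/- If for every t ∈ ℝ either B(t) > 0 or w'(t) ≠ 0, then for every t ∈ ℝ and α ∈ ℝ^{L−1} one has N(t) B(t) + A(t,α)² > 0; consequently the matrix g(t,α) is invertible at every point. -/
/-!
Formalization of results from "A geometric approach to equilibrium selection":
the metric, Christoffel symbols and curvature of the equilibrium manifold of a
two-consumer exchange economy with `L` goods, parametrized by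
`Φ(t,α) = (p_1(t),…,p_{L−1}(t), α_1,…,α_{L−1}, w(t) − Σ_m p_m(t) α_m)`.

Indices run over `Fin L`, where the index `0` corresponds to the coordinate
`x_0 = t` and an index `i ≠ 0` corresponds to the coordinate `x_i = α_i`
(the component `α 0` of `α : Fin L → ℝ` is never used, so `α` is just a copy
of `ℝ^{L−1}` together with an irrelevant extra coordinate).
-/

open Matrix BigOperators

noncomputable section

namespace EqSelection

variable {L : ℕ}

/-- If `B` vanishes then all `p_m'` vanish, so `A` reduces to `w'`. -/
theorem eqA_eq_deriv_of_eqB_eq_zero [NeZero L] {p : Fin L → ℝ → ℝ} {t : ℝ} (h : eqB p t = 0)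
    (w : ℝ → ℝ) (α : Fin L → ℝ) : eqA p w t α = deriv w t := by
  have h0 := (Finset.sum_eq_zero_iff_of_nonneg fun m _ => sq_nonneg (deriv (p m) t)).1 h
  rw [eqA, Finset.sum_eq_zero, sub_zero]
  intro m hm
  rw [pow_eq_zero_iff two_ne_zero |>.1 (h0 m hm), zero_mul]

theorem eqB_nonneg [NeZero L] (p : Fin L → ℝ → ℝ) (t : ℝ) : 0 ≤ eqB p t :=
  Finset.sum_nonneg fun _ _ => sq_nonneg _

theorem eqN_pos [NeZero L] (p : Fin L → ℝ → ℝ) (t : ℝ) : 0 < eqN p t :=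
  add_pos_of_pos_of_nonneg one_pos (Finset.sum_nonneg fun _ _ => sq_nonneg _)

theorem eqN_mul_eqB_add_sq_eqA_pos [NeZero L] {p : Fin L → ℝ → ℝ} {w : ℝ → ℝ} {t : ℝ}
    (h : 0 < eqB p t ∨ deriv w t ≠ 0) (α : Fin L → ℝ) :
    0 < eqN p t * eqB p t + (eqA p w t α) ^ 2 := by
  have hN := eqN_pos p t
  rcases (eqB_nonneg p t).eq_or_lt with hB | hB
  · have hw : deriv w t ≠ 0 := h.resolve_left hB.not_lt
    rw [eqA_eq_deriv_of_eqB_eq_zero hB.symm, ← hB]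
    positivity
  · positivity

theorem gMat_mulVec_zero [NeZero L] (p : Fin L → ℝ → ℝ) (w : ℝ → ℝ) (t : ℝ)
    (α v : Fin L → ℝ) :
    (gMat p w t α *ᵥ v) 0 = eqB p t * v 0 -
      eqA p w t α * (∑ m ∈ Finset.univ \ {0}, p m t * v m - eqA p w t α * v 0) := by
  rw [mulVec, dotProduct, ← Finset.sum_sdiff (Finset.subset_univ {0}), Finset.sum_singleton,
    mul_sub, Finset.mul_sum]
  have h : ∀ m ∈ Finset.univ \ {(0 : Fin L)},
      gMat p w t α 0 m * v m = -(eqA p w t α * (p m t * v m)) := by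
    intro m hm
    have hm0 : m ≠ 0 := by simpa using hm
    simp only [gMat, of_apply, if_true, if_neg hm0]
    ring
  rw [Finset.sum_congr rfl h, Finset.sum_neg_distrib]
  simp only [gMat, of_apply, if_true]
  ring

theorem gMat_mulVec_of_ne_zero [NeZero L] (p : Fin L → ℝ → ℝ) (w : ℝ → ℝ) (t : ℝ)
    (α v : Fin L → ℝ) {i : Fin L} (hi : i ≠ 0) :
    (gMat p w t α *ᵥ v) i =
      p i t * (∑ m ∈ Finset.univ \ {0}, p m t * v m - eqA p w t α * v 0) + v i := by
  rw [mulVec, dotProduct, ← Finset.sum_sdiff (Finset.subset_univ {0}), Finset.sum_singleton,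
    mul_sub, Finset.mul_sum]
  have h : ∀ m ∈ Finset.univ \ {(0 : Fin L)},
      gMat p w t α i m * v m = p i t * (p m t * v m) + if i = m then v m else 0 := by
    intro m hm
    have hm0 : m ≠ 0 := by simpa using hm
    simp only [gMat, of_apply, if_neg hi, if_neg hm0]
    split_ifs <;> ring
  have hmem : i ∈ Finset.univ \ {(0 : Fin L)} := by simpa using hi
  rw [Finset.sum_congr rfl h, Finset.sum_add_distrib, Finset.sum_ite_eq, if_pos hmem]
  simp only [gMat, of_apply, if_true, if_neg hi]
  ring

theorem isUnit_gMat [NeZero L] {p : Fin L → ℝ → ℝ} {w : ℝ → ℝ} {t : ℝ} {α : Fin L → ℝ}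
    (h : 0 < eqN p t * eqB p t + (eqA p w t α) ^ 2) : IsUnit (gMat p w t α) := by
  rw [← mulVec_injective_iff_isUnit]
  refine (injective_iff_map_eq_zero (gMat p w t α).mulVecLin).2 fun v hv => ?_
  rw [mulVecLin_apply] at hv
  have h0 := gMat_mulVec_zero p w t α v
  have hi := fun i (hi : i ≠ 0) => gMat_mulVec_of_ne_zero p w t α v hi
  simp only [hv, Pi.zero_apply] at h0 hi
  set S := ∑ m ∈ Finset.univ \ {0}, p m t * v m with hS
  set s := S - eqA p w t α * v 0 with hs
  have hvi : ∀ i, i ≠ 0 → v i = -(s * p i t) := fun i h => by linarith [hi i h]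
  have hSN : S = -(s * (eqN p t - 1)) := by
    rw [hS, eqN, add_sub_cancel_left, Finset.mul_sum, ← Finset.sum_neg_distrib]
    refine Finset.sum_congr rfl fun m hm => ?_
    rw [hvi m (by simpa using hm)]
    ring
  have hNs : eqN p t * s = -(eqA p w t α * v 0) := by linarith
  have hv0 : v 0 = 0 := by
    refine (mul_eq_zero.1 (?_ : _ * v 0 = 0)).resolve_left h.ne'
    linear_combination -eqN p t * h0 + eqA p w t α * hNs
  have hs0 : s = 0 := by
    refine (mul_eq_zero.1 (?_ : eqN p t * s = 0)).resolve_left (eqN_pos p t).ne'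
    rw [hNs, hv0, mul_zero, neg_zero]
  ext i
  by_cases hi0 : i = 0
  · rw [hi0, hv0, Pi.zero_apply]
  · rw [hvi i hi0, hs0, zero_mul, neg_zero, Pi.zero_apply]

theorem statement_3 (L : ℕ) [NeZero L] (hL : 2 ≤ L)
    (p : Fin L → ℝ → ℝ) (w : ℝ → ℝ)
    (hp : ∀ i, ContDiff ℝ (⊤ : ℕ∞) (p i)) (hw : ContDiff ℝ (⊤ : ℕ∞) w)
    (hreg : ∀ t : ℝ, 0 < eqB p t ∨ deriv w t ≠ 0) :
    ∀ (t : ℝ) (α : Fin L → ℝ),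
      0 < eqN p t * eqB p t + (eqA p w t α) ^ 2 ∧ IsUnit (gMat p w t α) := by
  intro t α
  have h := eqN_mul_eqB_add_sq_eqA_pos (hreg t) α
  exact ⟨h, isUnit_gMat h⟩

end EqSelection
end
end

section
/- If B(t) + A(t,α)² > 0 at a point (t,α) ∈ ℝ × ℝ^{L−1}, then the L vectors Φ_0(t,α), Φ_1(t,α), …, Φ_{L−1}(t,α) are linearly independent in ℝ^{2L−1}; in particular the matrix g(t,α), being their Gram matrix, is positive definite at such a point. -/
/-!
Formalization of results from "A geometric approach to equilibrium selection":
the metric, Christoffel symbols and curvature of the equilibrium manifold of a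
two-consumer exchange economy with `L` goods, parametrized by
`Φ(t,α) = (p_1(t),…,p_{L−1}(t), α_1,…,α_{L−1}, w(t) − Σ_m p_m(t) α_m)`.

Indices run over `Fin L`, where the index `0` corresponds to the coordinate
`x_0 = t` and an index `i ≠ 0` corresponds to the coordinate `x_i = α_i`
(the component `α 0` of `α : Fin L → ℝ` is never used, so `α` is just a copy
of `ℝ^{L−1}` together with an irrelevant extra coordinate).
-/

open Matrix BigOperators

noncomputable section

namespace EqSelection

variable {L : ℕ}

/-- The coordinates of `ℝ^{2n+1}` split into two blocks of length `n` and a last one. -/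
theorem sum_fin_two_mul_succ_sub_one {n : ℕ} (f : Fin (2 * (n + 1) - 1) → ℝ) :
    ∑ j, f j = ∑ m : Fin n, f ⟨m, by omega⟩ + ∑ m : Fin n, f ⟨n + m, by omega⟩
      + f ⟨2 * n, by omega⟩ := by
  have h : n + n + 1 = 2 * (n + 1) - 1 := by omega
  rw [← (finCongr h).sum_comp f, Fin.sum_univ_castSucc, Fin.sum_univ_add]
  congr 2
  simp [Fin.ext_iff, two_mul]

theorem sum_univ_sdiff_zero {n : ℕ} (f : Fin (n + 1) → ℝ) :
    ∑ m ∈ Finset.univ \ {0}, f m = ∑ m : Fin n, f m.succ := by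
  rw [Finset.sum_sdiff_eq_sub (Finset.subset_univ _), Fin.sum_univ_succ]
  simp

section Coordinates

variable {n : ℕ} (p : Fin (n + 1) → ℝ → ℝ) (w : ℝ → ℝ) (t : ℝ)
  (α : Fin (n + 1) → ℝ)

theorem eqB_eq_sum_succ : eqB p t = ∑ m : Fin n, (deriv (p m.succ) t) ^ 2 :=
  sum_univ_sdiff_zero _

theorem PhiVec_zero_first (m : Fin n) (h : (m : ℕ) < 2 * (n + 1) - 1) :
    PhiVec p w 0 t α ⟨m, h⟩ = deriv (p m.succ) t := by
  simp [PhiVec, Fin.succ]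

theorem PhiVec_zero_second (m : Fin n) (h : n + (m : ℕ) < 2 * (n + 1) - 1) :
    PhiVec p w 0 t α ⟨n + m, h⟩ = 0 := by
  have h' : n + (m : ℕ) ≠ 2 * (n + 1) - 2 := by omega
  simp [PhiVec, h']

theorem PhiVec_zero_last (h : 2 * n < 2 * (n + 1) - 1) :
    PhiVec p w 0 t α ⟨2 * n, h⟩ = eqA p w t α := by
  have h₁ : ¬ 2 * n < n := by omega
  have h₂ : 2 * n = 2 * (n + 1) - 2 := by omega
  simp [PhiVec, h₁, ← h₂]

theorem PhiVec_succ_first (i m : Fin n) (h : (m : ℕ) < 2 * (n + 1) - 1) :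
    PhiVec p w i.succ t α ⟨m, h⟩ = 0 := by
  have h₁ : ¬ (m : ℕ) + 1 = n + (i + 1) := by omega
  have h₂ : (m : ℕ) ≠ 2 * (n + 1) - 2 := by omega
  simp [PhiVec, h₁, h₂]

theorem PhiVec_succ_second (i m : Fin n) (h : n + (m : ℕ) < 2 * (n + 1) - 1) :
    PhiVec p w i.succ t α ⟨n + m, h⟩ = if i = m then 1 else 0 := by
  have h₁ : n + (m : ℕ) + 1 = n + (i + 1) ↔ i = m := by omega
  have h₂ : n + (m : ℕ) ≠ 2 * (n + 1) - 2 := by omega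
  simp [PhiVec, h₁, h₂]

theorem PhiVec_succ_last (i : Fin n) (h : 2 * n < 2 * (n + 1) - 1) :
    PhiVec p w i.succ t α ⟨2 * n, h⟩ = -(p i.succ t) := by
  have h₁ : ¬ 2 * n + 1 = n + (i + 1) := by omega
  have h₂ : 2 * n = 2 * (n + 1) - 2 := by omega
  simp [PhiVec, h₁, ← h₂]

/-- The metric `g` is the Gram matrix of the tangent vectors `Φ_i`. -/
theorem gMat_eq_gram :
    gMat p w t α = (Matrix.of fun i => PhiVec p w i t α) *
      (Matrix.of fun i => PhiVec p w i t α)ᴴ := by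
  ext i j
  simp only [Matrix.mul_apply, Matrix.conjTranspose_apply, Matrix.of_apply, star_trivial,
    sum_fin_two_mul_succ_sub_one]
  cases i using Fin.cases <;> cases j using Fin.cases <;>
    simp only [PhiVec_zero_first, PhiVec_zero_second, PhiVec_zero_last, PhiVec_succ_first,
      PhiVec_succ_second, PhiVec_succ_last] <;>
    simp [gMat, eqB_eq_sum_succ, pow_two, mul_comm, add_comm]

theorem linearIndependent_PhiVec (hpos : 0 < eqB p t + (eqA p w t α) ^ 2) :
    LinearIndependent ℝ (fun i => PhiVec p w i t α) := by
  rw [Fintype.linearIndependent_iff]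
  intro c hc
  have hcoord (j) :
      c 0 * PhiVec p w 0 t α j + ∑ i : Fin n, c i.succ * PhiVec p w i.succ t α j = 0 := by
    simpa [Fin.sum_univ_succ] using congrFun hc j
  have hsucc (m : Fin n) : c m.succ = 0 := by
    have h := hcoord ⟨n + m, by omega⟩
    simp only [PhiVec_zero_second, PhiVec_succ_second] at h
    simpa using h
  have hp (m : Fin n) : c 0 = 0 ∨ deriv (p m.succ) t = 0 := by
    have h := hcoord ⟨m, by omega⟩
    simp only [PhiVec_zero_first, PhiVec_succ_first] at h
    simpa using h
  have hA : c 0 = 0 ∨ eqA p w t α = 0 := by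
    have h := hcoord ⟨2 * n, by omega⟩
    simp only [PhiVec_zero_last, hsucc] at h
    simpa using h
  have hzero : c 0 = 0 := by
    by_contra h
    simp [eqB_eq_sum_succ, hA.resolve_left h, fun m => (hp m).resolve_left h] at hpos
  exact Fin.cases hzero hsucc

end Coordinates

theorem statement_4 (L : ℕ) [NeZero L] (hL : 2 ≤ L)
    (p : Fin L → ℝ → ℝ) (w : ℝ → ℝ)
    (hp : ∀ i, ContDiff ℝ (⊤ : ℕ∞) (p i)) (hw : ContDiff ℝ (⊤ : ℕ∞) w)
    (t : ℝ) (α : Fin L → ℝ) (hpos : 0 < eqB p t + (eqA p w t α) ^ 2) :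
    LinearIndependent ℝ (fun i : Fin L => PhiVec p w i t α)
      ∧ (gMat p w t α).PosDef := by
  obtain ⟨n, rfl⟩ : ∃ n, L = n + 1 := ⟨L - 1, by omega⟩
  have hli := linearIndependent_PhiVec p w t α hpos
  refine ⟨hli, ?_⟩
  rw [gMat_eq_gram]
  exact Matrix.PosDef.mul_conjTranspose_self _ (Matrix.vecMul_injective_iff.mpr hli)

end EqSelection
end
end

section
/- For all indices i, j with 1 ≤ i, j ≤ L−1 and every index k with 0 ≤ k ≤ L−1, the Christoffel symbol Γ^k_{ij}(t,α) vanishes identically on ℝ × ℝ^{L−1}. -/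
/-!
Formalization of results from "A geometric approach to equilibrium selection":
the metric, Christoffel symbols and curvature of the equilibrium manifold of a
two-consumer exchange economy with `L` goods, parametrized by
`Φ(t,α) = (p_1(t),…,p_{L−1}(t), α_1,…,α_{L−1}, w(t) − Σ_m p_m(t) α_m)`.

Indices run over `Fin L`, where the index `0` corresponds to the coordinate
`x_0 = t` and an index `i ≠ 0` corresponds to the coordinate `x_i = α_i`
(the component `α 0` of `α : Fin L → ℝ` is never used, so `α` is just a copy
of `ℝ^{L−1}` together with an irrelevant extra coordinate).
-/

open Matrix BigOperators

noncomputable section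

namespace EqSelection

variable {L : ℕ}

/-- The partial derivative of `A` in the direction `α_i`, `i ≠ 0`, is `-p_i'`. -/
theorem hasDerivAt_eqA_update [NeZero L] (p : Fin L → ℝ → ℝ) (w : ℝ → ℝ) {i : Fin L}
    (hi : i ≠ 0) (t : ℝ) (α : Fin L → ℝ) (x : ℝ) :
    HasDerivAt (fun s => eqA p w t (Function.update α i s)) (-deriv (p i) t) x := by
  have hsum : HasDerivAt
      (fun s => ∑ m ∈ Finset.univ \ {0}, deriv (p m) t * Function.update α i s m)
      (∑ m ∈ Finset.univ \ {0}, deriv (p m) t * (Pi.single i (1 : ℝ) : Fin L → ℝ) m) x :=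
    HasDerivAt.fun_sum fun m _ =>
      ((hasDerivAt_pi.1 (hasDerivAt_update α i x)) m).const_mul _
  have hval : ∑ m ∈ Finset.univ \ {0}, deriv (p m) t * (Pi.single i (1 : ℝ) : Fin L → ℝ) m
      = deriv (p i) t := by
    simp [Pi.single_apply, hi]
  rw [hval] at hsum
  exact hsum.const_sub (deriv w t)

/-- The metric entries `g_{0j}` satisfy `∂g_{0j}/∂α_i = p_j p_i'`. -/
theorem pder_neg_mul_eqA [NeZero L] (p : Fin L → ℝ → ℝ) (w : ℝ → ℝ) {i : Fin L}
    (hi : i ≠ 0) (j : Fin L) (t : ℝ) (α : Fin L → ℝ) :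
    pder i (fun t' α' => -(p j t') * eqA p w t' α') t α = p j t * deriv (p i) t := by
  rw [pder, if_neg hi, ((hasDerivAt_eqA_update p w hi t α (α i)).const_mul _).deriv]
  ring

/-- A function of `t` alone has vanishing partial derivatives in the directions `α_i`. -/
theorem pder_of_ne_zero_const [NeZero L] {i : Fin L} (hi : i ≠ 0) (f : ℝ → ℝ) (t : ℝ)
    (α : Fin L → ℝ) : pder i (fun t' _ => f t') t α = 0 := by
  simp [pder, hi]

theorem statement_5 (L : ℕ) [NeZero L] (hL : 2 ≤ L)
    (p : Fin L → ℝ → ℝ) (w : ℝ → ℝ)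
    (hp : ∀ i, ContDiff ℝ (⊤ : ℕ∞) (p i)) (hw : ContDiff ℝ (⊤ : ℕ∞) w)
    (hreg : ∀ t : ℝ, 0 < eqB p t ∨ deriv w t ≠ 0) :
    ∀ i j k : Fin L, i ≠ 0 → j ≠ 0 →
      ∀ (t : ℝ) (α : Fin L → ℝ), christoffel p w i j k t α = 0 := by
  intro i j k hi hj t α
  unfold christoffel
  rw [Finset.sum_eq_zero, mul_zero]
  intro h _
  refine mul_eq_zero_of_right _ ?_
  by_cases hh : h = 0
  · subst hh
    have hdi := ((hp i).differentiable (by simp)) t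
    have hdj := ((hp j).differentiable (by simp)) t
    have hprod : pder 0 (fun t' (_ : Fin L → ℝ) => p i t' * p j t' + (if i = j then 1 else 0)) t α
        = deriv (p i) t * p j t + p i t * deriv (p j) t := by
      rw [pder, if_pos rfl]
      exact ((hdi.hasDerivAt.mul hdj.hasDerivAt).add_const _).deriv
    simp only [gMat, Matrix.of_apply, if_neg hi, if_neg hj, if_true]
    rw [pder_neg_mul_eqA p w hi, pder_neg_mul_eqA p w hj, hprod]
    ring
  · simp only [gMat, Matrix.of_apply, if_neg hi, if_neg hj, if_neg hh]
    rw [pder_of_ne_zero_const hi fun t => p j t * p h t + (if j = h then 1 else 0),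
      pder_of_ne_zero_const hj fun t => p h t * p i t + (if h = i then 1 else 0),
      pder_of_ne_zero_const hh fun t => p i t * p j t + (if i = j then 1 else 0)]
    ring

end EqSelection
end
end
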